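/- Fix a DEM iteration sequence as follows: let (θ_t)_{t≥0} be a sequence in Θ, (μ_t)_{t≥0} a sequence of K-tuples of probability measures, and (U_{t+1})_{t≥0} subsets of {1,…,K}, such that for every t ≥ 0: μ_{t+1,k} = h_k(θ_t) for k ∈ U_{t+1} and μ_{t+1,k} = μ_{t,k} for k ∉ U_{t+1}; F(μ_{t+1}, θ_{t+1}) ≥ F(μ_{t+1}, θ_t); and KL(μ_{t,k} ‖ h_k(θ_t)) < ∞ for all t, k. Suppose in addition that F(μ_t, θ_t) converges to a real limit F̂ and that the set T = { t : U_{t+1} = {1,…,K} } is infinite. Then for t ∈ T one has L(θ_t) = F(μ_{t+1}, θ_t) with F(μ_t, θ_t) ≤ L(θ_t) ≤ F(μ_{t+1}, θ_{t+1}), where L(θ) = ∑_{k=1}^K L_k(θ); consequently L(θ_t) → F̂ along the subsequence t ∈ T. -/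

import Mathlib

open MeasureTheory Filter Topology

/-- Real-valued Kullback–Leibler divergence `∫ log(dμ/dν) dμ`. -/
noncomputable def klReal {α : Type*} [MeasurableSpace α] (μ ν : Measure α) : ℝ :=
  ∫ x, llr μ ν x ∂μ

/-- The KL divergence `KL(μ ‖ ν)` is finite: `μ ≪ ν` and the log-likelihood ratio is
`μ`-integrable. -/
def klFin {α : Type*} [MeasurableSpace α] (μ ν : Measure α) : Prop :=
  μ ≪ ν ∧ Integrable (llr μ ν) μ

/-- The free-energy functional `F(μ, θ) = ∑ k, (L_k(θ) − KL(μ_k ‖ h_k(θ)))`. -/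
noncomputable def freeEnergy {K : ℕ} {Θ : Type*} {Y : Fin K → Type*}
    [∀ k, MeasurableSpace (Y k)] (L : Fin K → Θ → ℝ)
    (h : Θ → ∀ k, Measure (Y k)) (μ : ∀ k, Measure (Y k)) (θ : Θ) : ℝ :=
  ∑ k : Fin K, (L k θ - klReal (μ k) (h θ k))

/-- A probability measure has zero divergence from itself. -/
theorem klReal_self {α : Type*} [MeasurableSpace α] (μ : Measure α) [IsProbabilityMeasure μ] :
    klReal μ μ = 0 := by
  simp [klReal, integral_congr_ae (llr_self μ)]

/-- Gibbs' inequality for probability measures. -/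
theorem klReal_nonneg {α : Type*} [MeasurableSpace α] {μ ν : Measure α}
    [IsProbabilityMeasure μ] [IsProbabilityMeasure ν] (hfin : klFin μ ν) : 0 ≤ klReal μ ν := by
  simpa [klReal] using
    InformationTheory.integral_llr_add_sub_measure_univ_nonneg hfin.1 hfin.2

/-- Along iterations where every worker reports (`U_{t+1} = {1,…,K}`), the observed-data
objective `L(θ_t) = ∑ k, L_k(θ_t)` equals `F(μ_{t+1}, θ_t)`, is squeezed between
`F(μ_t, θ_t)` and `F(μ_{t+1}, θ_{t+1})`, and hence converges to the limit `F̂` of the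
free-energy sequence along that subsequence. -/
theorem dem_loglik_subsequence_converges
    {K : ℕ} (hK : 0 < K) {Θ : Type*} [Nonempty Θ]
    {Y : Fin K → Type*} [∀ k, MeasurableSpace (Y k)]
    (L : Fin K → Θ → ℝ) (h : Θ → ∀ k, Measure (Y k))
    (hprob : ∀ θ k, IsProbabilityMeasure (h θ k))
    (θseq : ℕ → Θ) (μseq : ℕ → ∀ k, Measure (Y k))
    (hμprob : ∀ t k, IsProbabilityMeasure (μseq t k))
    (U : ℕ → Set (Fin K))
    (hE_update : ∀ t, ∀ k ∈ U t, μseq (t + 1) k = h (θseq t) k)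
    (hE_keep : ∀ t, ∀ k ∉ U t, μseq (t + 1) k = μseq t k)
    (hM : ∀ t, freeEnergy L h (μseq (t + 1)) (θseq (t + 1)) ≥
      freeEnergy L h (μseq (t + 1)) (θseq t))
    (hfin : ∀ t k, klFin (μseq t k) (h (θseq t) k))
    (Fhat : ℝ)
    (hconv : Tendsto (fun t => freeEnergy L h (μseq t) (θseq t)) atTop (𝓝 Fhat))
    (T : Set ℕ) (hT : T = {t | U t = Set.univ}) (hTinf : T.Infinite) :
    (∀ t ∈ T,
      (∑ k : Fin K, L k (θseq t)) = freeEnergy L h (μseq (t + 1)) (θseq t) ∧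
      freeEnergy L h (μseq t) (θseq t) ≤ ∑ k : Fin K, L k (θseq t) ∧
      (∑ k : Fin K, L k (θseq t)) ≤ freeEnergy L h (μseq (t + 1)) (θseq (t + 1))) ∧
    Tendsto (fun t => ∑ k : Fin K, L k (θseq t)) (atTop ⊓ 𝓟 T) (𝓝 Fhat) := by
  have key : ∀ t ∈ T,
      (∑ k : Fin K, L k (θseq t)) = freeEnergy L h (μseq (t + 1)) (θseq t) ∧
      freeEnergy L h (μseq t) (θseq t) ≤ ∑ k : Fin K, L k (θseq t) ∧
      (∑ k : Fin K, L k (θseq t)) ≤ freeEnergy L h (μseq (t + 1)) (θseq (t + 1)) := by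
    intro t ht
    have hU : U t = Set.univ := by simpa [hT] using ht
    have heq : (∑ k : Fin K, L k (θseq t)) = freeEnergy L h (μseq (t + 1)) (θseq t) := by
      refine Finset.sum_congr rfl fun k _ => ?_
      rw [hE_update t k (hU ▸ Set.mem_univ k), klReal_self, sub_zero]
    refine ⟨heq, Finset.sum_le_sum fun k _ => ?_, heq.trans_le (hM t)⟩
    exact sub_le_self _ (klReal_nonneg (hfin t k))
  refine ⟨key, ?_⟩
  have hT_mem : ∀ᶠ t in atTop ⊓ 𝓟 T, t ∈ T := mem_inf_of_right (mem_principal_self T)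
  exact tendsto_of_tendsto_of_tendsto_of_le_of_le' (hconv.mono_left inf_le_left)
    ((hconv.comp (tendsto_add_atTop_nat 1)).mono_left inf_le_left)
    (hT_mem.mono fun t ht => (key t ht).2.1) (hT_mem.mono fun t ht => (key t ht).2.2)
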